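/- For every testing context 𝒟, the 𝒟-box equivalence is strictly contained in the 𝒟-diamond equivalence: =□^𝒟 ⊆ =◇^𝒟, and the inclusion is strict, witnessed by the processes τ.a and τ.a + τ.(μX.τ.X), whose Dirac distributions are 𝒟-diamond equivalent but not 𝒟-box equivalent. -/

import Mathlib

open scoped Classical

/-! ## Channels, actions, RCCS terms -/

/-- Channels, drawn from an infinite set. -/
abbrev Chan := ℕ

/-- Actions: input/output labels over channels, the silent action `τ`, and the
distinguished success action `ω` (used only by observers). -/
inductive Act where
  | inp : Chan → Act
  | out : Chan → Act
  | tau : Act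
  | omega : Act
deriving DecidableEq

/-- `α` is an external label, i.e. a member of `𝓛 = N ∪ N̄`. -/
def Act.IsLabel : Act → Prop
  | .inp _ => True
  | .out _ => True
  | _ => False

/-- Complementary labels (for communication). -/
def Act.Comp : Act → Act → Prop := fun x y =>
  ∃ a, (x = .inp a ∧ y = .out a) ∨ (x = .out a ∧ y = .inp a)

/-- `β, β̄ ∉ L`: the action is not blocked by the localization `(L)-`. -/
def Act.Allowed (L : Finset Chan) : Act → Prop
  | .inp a => a ∉ L
  | .out a => a ∉ L
  | _ => True

/-- Channels occurring in an action. -/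
def Act.chans : Act → Finset Chan
  | .inp a => {a}
  | .out a => {a}
  | _ => ∅

/-- RCCS (and RCCS^ω) terms, with de Bruijn indices for process variables.
`sum k acts conts` is the nondeterministic choice `Σ_{i∈I} α_i.T_i` over the
nonempty finite index set `I = Fin (k+1)`, and `oplus k w conts` is the
probabilistic choice `⊕_{i∈I} p_i τ.T_i`. `fix T` is `μX.T` (binding index 0). -/
inductive Tm where
  | nil : Tm
  | var : ℕ → Tm
  | sum : (k : ℕ) → (Fin (k+1) → Act) → (Fin (k+1) → Tm) → Tm
  | oplus : (k : ℕ) → (Fin (k+1) → ℝ) → (Fin (k+1) → Tm) → Tm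
  | par : Tm → Tm → Tm
  | loc : Finset Chan → Tm → Tm
  | fix : Tm → Tm

/-- Substitution `T{P/X}` of a (closed) term `P` for the de Bruijn variable `n`. -/
def Tm.subst (P : Tm) : ℕ → Tm → Tm
  | _, .nil => .nil
  | n, .var m => if m = n then P else .var m
  | n, .sum k a c => .sum k a (fun i => Tm.subst P n (c i))
  | n, .oplus k w c => .oplus k w (fun i => Tm.subst P n (c i))
  | n, .par S T => .par (Tm.subst P n S) (Tm.subst P n T)
  | n, .loc L T => .loc L (Tm.subst P n T)
  | n, .fix T => .fix (Tm.subst P (n+1) T)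

/-- `T` has all its free variables among the first `n` de Bruijn indices.
`ClosedAt 0 T` means `T` is closed; `ClosedAt 1 T` means at most one free variable. -/
def Tm.ClosedAt : ℕ → Tm → Prop
  | _, .nil => True
  | n, .var m => m < n
  | n, .sum _ _ c => ∀ i, Tm.ClosedAt n (c i)
  | n, .oplus _ _ c => ∀ i, Tm.ClosedAt n (c i)
  | n, .par S T => Tm.ClosedAt n S ∧ Tm.ClosedAt n T
  | n, .loc _ T => Tm.ClosedAt n T
  | n, .fix T => Tm.ClosedAt (n+1) T

/-- The success action `ω` does not occur in `T` (so `T` is a genuine RCCS term). -/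
def Tm.NoOmega : Tm → Prop
  | .nil => True
  | .var _ => True
  | .sum _ a c => (∀ i, a i ≠ Act.omega) ∧ (∀ i, Tm.NoOmega (c i))
  | .oplus _ _ c => ∀ i, Tm.NoOmega (c i)
  | .par S T => Tm.NoOmega S ∧ Tm.NoOmega T
  | .loc _ T => Tm.NoOmega T
  | .fix T => Tm.NoOmega T

/-- No probabilistic choice occurs in `T` (so `T` is a CCS term). -/
def Tm.NoOplus : Tm → Prop
  | .nil => True
  | .var _ => True
  | .sum _ _ c => ∀ i, Tm.NoOplus (c i)
  | .oplus _ _ _ => False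
  | .par S T => Tm.NoOplus S ∧ Tm.NoOplus T
  | .loc _ T => Tm.NoOplus T
  | .fix T => Tm.NoOplus T

/-- The channels `N(T)` occurring in a term. -/
def Tm.chans : Tm → Finset Chan
  | .nil => ∅
  | .var _ => ∅
  | .sum _ a c =>
      (Finset.univ.sup fun i => (a i).chans) ∪ (Finset.univ.sup fun i => Tm.chans (c i))
  | .oplus _ _ c => Finset.univ.sup fun i => Tm.chans (c i)
  | .par S T => S.chans ∪ T.chans
  | .loc L T => L ∪ T.chans
  | .fix T => T.chans

/-- Renaming of channels in an action. -/
def Act.rename (f : Chan → Chan) : Act → Act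
  | .inp a => .inp (f a)
  | .out a => .out (f a)
  | x => x

/-- Renaming `T[f]` of the global channels of a term (local channels are untouched). -/
def Tm.rename : (Chan → Chan) → Tm → Tm
  | _, .nil => .nil
  | _, .var m => .var m
  | f, .sum k a c => .sum k (fun i => (a i).rename f) (fun i => Tm.rename f (c i))
  | f, .oplus k w c => .oplus k w (fun i => Tm.rename f (c i))
  | f, .par S T => .par (Tm.rename f S) (Tm.rename f T)
  | f, .loc L T => .loc L (Tm.rename (fun a => if a ∈ L then a else f a) T)
  | f, .fix T => .fix (Tm.rename f T)

/-- `P` is an RCCS process: closed and without the success action. -/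
def Tm.IsProc (P : Tm) : Prop := Tm.ClosedAt 0 P ∧ Tm.NoOmega P

/-- `P` is a CCS process: a process without probabilistic choice. -/
def Tm.IsCCS (P : Tm) : Prop := P.IsProc ∧ Tm.NoOplus P

/-! ## Finitely supported distributions -/

/-- Finitely supported probability distributions on `α`. -/
structure FinDist (α : Type) where
  toFun : α → ℝ
  nonneg : ∀ a, 0 ≤ toFun a
  finite_support : (Function.support toFun).Finite
  sum_one : ∑ᶠ a, toFun a = 1

namespace FinDist

/-- The probability `μ(φ)` that a predicate (set) `φ` holds under `μ`. -/
noncomputable def mass {α : Type} (μ : FinDist α) (φ : Set α) : ℝ :=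
  ∑ᶠ a ∈ φ, μ.toFun a

/-- The Dirac distribution `δ_P`. -/
noncomputable def dirac {α : Type} (P : α) : FinDist α where
  toFun := fun Q => if Q = P then 1 else 0
  nonneg := by intro a; by_cases h : a = P <;> simp [h]
  finite_support := by
    apply Set.Finite.subset (Set.finite_singleton P)
    intro a ha
    by_contra h
    simp only [Set.mem_singleton_iff] at h
    simp [Function.mem_support, h] at ha
  sum_one := by
    rw [finsum_eq_single _ P (fun b hb => by simp [hb])]
    simp

/-- Pushforward of a finitely supported distribution along a map. -/
noncomputable def map {α β : Type} (g : α → β) (μ : FinDist α) : FinDist β where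
  toFun := fun b => ∑ᶠ a ∈ {a | g a = b}, μ.toFun a
  nonneg := by
    intro b
    exact finsum_nonneg fun a => finsum_nonneg fun _ => μ.nonneg a
  finite_support := by
    apply Set.Finite.subset (μ.finite_support.image g)
    intro b hb
    rw [Function.mem_support] at hb
    by_contra h
    apply hb
    apply finsum_mem_eq_zero_of_forall_eq_zero
    intro a ha
    by_contra ha0
    exact h ⟨a, Function.mem_support.mpr ha0, ha⟩
  sum_one := by
    classical
    set s := μ.finite_support.toFinset with hs
    have hfib : ∀ b : β, (∑ᶠ a ∈ {a | g a = b}, μ.toFun a)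
        = ∑ a ∈ s.filter (fun a => g a = b), μ.toFun a := by
      intro b
      apply finsum_mem_eq_sum_of_inter_support_eq
      ext a
      simp only [Set.mem_inter_iff, Set.mem_setOf_eq, Finset.coe_filter,
        Set.Finite.mem_toFinset, Function.mem_support, hs]
      tauto
    have hsub : Function.support (fun b : β => ∑ᶠ a ∈ {a | g a = b}, μ.toFun a) ⊆
        ↑(s.image g) := by
      intro b hb
      rw [Function.mem_support, hfib] at hb
      obtain ⟨a, ha, hne⟩ := Finset.exists_ne_zero_of_sum_ne_zero hb
      rw [Finset.mem_filter] at ha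
      simp only [Finset.coe_image, Set.mem_image, Finset.mem_coe]
      exact ⟨a, ha.1, ha.2⟩
    rw [finsum_eq_finset_sum_of_support_subset _ hsub]
    calc ∑ b ∈ s.image g, ∑ᶠ a ∈ {a | g a = b}, μ.toFun a
        = ∑ b ∈ s.image g, ∑ a ∈ s.filter (fun a => g a = b), μ.toFun a :=
          Finset.sum_congr rfl fun b _ => hfib b
      _ = ∑ a ∈ s, μ.toFun a :=
          Finset.sum_fiberwise_of_maps_to (fun a ha => Finset.mem_image_of_mem g ha)
            μ.toFun
      _ = 1 := by rw [← finsum_eq_sum μ.toFun μ.finite_support]; exact μ.sum_one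

/-- The product of two finitely supported distributions. -/
noncomputable def prod {α β : Type} (μ : FinDist α) (ν : FinDist β) :
    FinDist (α × β) where
  toFun := fun x => μ.toFun x.1 * ν.toFun x.2
  nonneg := fun x => mul_nonneg (μ.nonneg _) (ν.nonneg _)
  finite_support := by
    apply Set.Finite.subset (μ.finite_support.prod ν.finite_support)
    intro x hx
    rw [Function.mem_support] at hx
    have h := mul_ne_zero_iff.mp hx
    exact ⟨Function.mem_support.mpr h.1, Function.mem_support.mpr h.2⟩
  sum_one := by
    classical
    have hsub : Function.support (fun x : α × β => μ.toFun x.1 * ν.toFun x.2) ⊆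
        ↑(μ.finite_support.toFinset ×ˢ ν.finite_support.toFinset) := by
      intro x hx
      rw [Function.mem_support] at hx
      have h := mul_ne_zero_iff.mp hx
      simp only [Finset.coe_product, Set.mem_prod, Set.Finite.coe_toFinset]
      exact ⟨h.1, h.2⟩
    rw [finsum_eq_finset_sum_of_support_subset _ hsub, Finset.sum_product]
    have h1 : ∑ a ∈ μ.finite_support.toFinset, μ.toFun a = 1 := by
      rw [← finsum_eq_sum μ.toFun μ.finite_support]; exact μ.sum_one
    have h2 : ∑ b ∈ ν.finite_support.toFinset, ν.toFun b = 1 := by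
      rw [← finsum_eq_sum ν.toFun ν.finite_support]; exact ν.sum_one
    calc ∑ a ∈ μ.finite_support.toFinset, ∑ b ∈ ν.finite_support.toFinset,
          μ.toFun a * ν.toFun b
        = ∑ a ∈ μ.finite_support.toFinset, μ.toFun a * 1 := by
          refine Finset.sum_congr rfl fun a _ => ?_
          rw [← Finset.mul_sum, h2]
      _ = 1 := by simpa using h1

/-- Parallel composition `μ | ν` of distributions:
`(μ|ν)(A|B) = μ(A)·ν(B)`. -/
noncomputable def parD (μ ν : FinDist Tm) : FinDist Tm :=
  (μ.prod ν).map fun x => Tm.par x.1 x.2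

/-- Localization `(L)μ` of a distribution. -/
noncomputable def locD (L : Finset Chan) (μ : FinDist Tm) : FinDist Tm :=
  μ.map (Tm.loc L)

/-- Renaming `μ[f]` of a distribution. -/
noncomputable def renameD (f : Chan → Chan) (μ : FinDist Tm) : FinDist Tm :=
  μ.map (Tm.rename f)

/-- Instantiation `ϑ[P]` of a 1-ary distribution `ϑ` at the process `P`. -/
noncomputable def instD (ϑ : FinDist Tm) (P : Tm) : FinDist Tm :=
  ϑ.map (fun T => Tm.subst P 0 T)

/-- Every element of the support is a process (`μ ∈ D(P_RCCS)`). -/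
def IsProcDist (μ : FinDist Tm) : Prop := ∀ P, μ.toFun P ≠ 0 → P.IsProc

/-- All channels occurring in (the support of) `μ` lie in `L`. -/
def chansIn (μ : FinDist Tm) (L : Finset Chan) : Prop :=
  ∀ P, μ.toFun P ≠ 0 → P.chans ⊆ L

/-- The channel `a` occurs in (the support of) `μ`, i.e. `a ∈ N(μ)`. -/
def hasChan (μ : FinDist Tm) (a : Chan) : Prop := ∃ P, μ.toFun P ≠ 0 ∧ a ∈ P.chans

end FinDist

/-! ## Part I: the probabilistic labelled transition system on processes -/

/-- Part I of the pLTS for RCCS (and RCCS^ω): `P →α ρ`. -/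
inductive Step : Tm → Act → FinDist Tm → Prop where
  | choice {k : ℕ} (acts : Fin (k+1) → Act) (conts : Fin (k+1) → Tm) (i : Fin (k+1)) :
      Step (.sum k acts conts) (acts i) (FinDist.dirac (conts i))
  | oplus {k : ℕ} (w : Fin (k+1) → ℝ) (conts : Fin (k+1) → Tm) (ρ : FinDist Tm) :
      (∀ i, 0 < w i ∧ w i < 1) →
      (∀ Q, ρ.toFun Q = ∑ i, if conts i = Q then w i else 0) →
      Step (.oplus k w conts) .tau ρ
  | parL {S : Tm} {α : Act} {ρ : FinDist Tm} (T : Tm) :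
      Step S α ρ → Step (.par S T) α (ρ.parD (FinDist.dirac T))
  | parR {T : Tm} {α : Act} {ρ : FinDist Tm} (S : Tm) :
      Step T α ρ → Step (.par S T) α ((FinDist.dirac S).parD ρ)
  | comm {S T : Tm} {ℓ1 ℓ2 : Act} {ρ1 ρ2 : FinDist Tm} :
      Act.Comp ℓ1 ℓ2 → Step S ℓ1 ρ1 → Step T ℓ2 ρ2 →
      Step (.par S T) .tau (ρ1.parD ρ2)
  | loc {T : Tm} {β : Act} {ρ : FinDist Tm} (L : Finset Chan) :
      Step T β ρ → Act.Allowed L β → Step (.loc L T) β (FinDist.locD L ρ)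
  | fixp {T : Tm} {β : Act} {ρ : FinDist Tm} :
      Step (Tm.subst (.fix T) 0 T) β ρ → Step (.fix T) β ρ

/-! ## Part II: probabilistic transitions on distributions -/

/-- Part II of the pLTS: `μ →(α,p) ν` iff `0 < p ≤ 1` and there are `P ∈ supp μ`
and `ρ` with `P →α ρ` and `ν = μ + μ(P)·p·(ρ − δ_P)`. -/
def PStep (μ : FinDist Tm) (α : Act) (p : ℝ) (ν : FinDist Tm) : Prop :=
  0 < p ∧ p ≤ 1 ∧
    ∃ P ρ, 0 < μ.toFun P ∧ Step P α ρ ∧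
      ∀ Q, ν.toFun Q = μ.toFun Q + μ.toFun P * p * (ρ.toFun Q - (if Q = P then 1 else 0))

/-- Probabilistic transition sequence `μ →π ν` along a word `π`. -/
def PSeq : FinDist Tm → List (Act × ℝ) → FinDist Tm → Prop
  | μ, [], ν => ν = μ
  | μ, s :: π, ν => ∃ μ', PStep μ s.1 s.2 μ' ∧ PSeq μ' π ν

/-- Internal transition sequence `μ ⇝ ν`. -/
def Internal (μ ν : FinDist Tm) : Prop :=
  ∃ π : List (Act × ℝ), (∀ s ∈ π, s.1 = Act.tau) ∧ PSeq μ π ν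

/-! ## Observability predicates and testing characteristics -/

/-- `ψ_𝓛`: processes that can immediately perform an external action. -/
def psiL : Set Tm := {P | ∃ α ρ, Act.IsLabel α ∧ Step P α ρ}

/-- `ψ_ω`: processes that can immediately perform the success action `ω`. -/
def psiOmega : Set Tm := {P | ∃ ρ, Step P Act.omega ρ}

/-- The may characteristic `χmay_𝓛(μ) = sup { ν(ψ_𝓛) : μ ⇝ ν }`. -/
noncomputable def chiMayL (μ : FinDist Tm) : ℝ :=
  sSup {x | ∃ ν, Internal μ ν ∧ x = ν.mass psiL}

/-- The fair characteristic `χfair_𝓛(μ) = inf { χmay_𝓛(ν) : μ ⇝ ν }`. -/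
noncomputable def chiFairL (μ : FinDist Tm) : ℝ :=
  sInf {x | ∃ ν, Internal μ ν ∧ x = chiMayL ν}

/-- `χmay_ω(μ) = sup { ν(ψ_ω) : μ ⇝ ν }`. -/
noncomputable def chiMayOmega (μ : FinDist Tm) : ℝ :=
  sSup {x | ∃ ν, Internal μ ν ∧ x = ν.mass psiOmega}

/-- `χfair_ω(μ) = inf { χmay_ω(ν) : μ ⇝ ν }`. -/
noncomputable def chiFairOmega (μ : FinDist Tm) : ℝ :=
  sInf {x | ∃ ν, Internal μ ν ∧ x = chiMayOmega ν}

/-! ## Testing contexts, equipollence, extensionality, diamond/box equivalences -/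

/-- `Δ(P_CCS) ⊆ 𝒟 ⊆ D(P_RCCS)`, closed under parallel composition, localization
and (finite-domain) renaming. -/
structure IsTestingContext (D : Set (FinDist Tm)) : Prop where
  dirac_ccs : ∀ P : Tm, P.IsCCS → FinDist.dirac P ∈ D
  proc_dist : ∀ μ ∈ D, μ.IsProcDist
  closed_par : ∀ μ ∈ D, ∀ ν ∈ D, μ.parD ν ∈ D
  closed_loc : ∀ μ ∈ D, ∀ L : Finset Chan, FinDist.locD L μ ∈ D
  closed_rename : ∀ μ ∈ D, ∀ f : Chan → Chan, {a | f a ≠ a}.Finite →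
      FinDist.renameD f μ ∈ D

/-- `R` is probabilistically equipollent. -/
def Equipollent (R : FinDist Tm → FinDist Tm → Prop) : Prop :=
  ∀ μ1 μ2, R μ1 μ2 → chiMayL μ1 = chiMayL μ2

/-- `R` is probabilistically strongly equipollent. -/
def StronglyEquipollent (R : FinDist Tm → FinDist Tm → Prop) : Prop :=
  ∀ μ1 μ2, R μ1 μ2 → chiFairL μ1 = chiFairL μ2

/-- `R` is `𝒟`-extensional. -/
def DExtensional (D : Set (FinDist Tm)) (R : FinDist Tm → FinDist Tm → Prop) : Prop :=
  ∀ μ1 μ2, R μ1 μ2 →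
    (∀ ν ∈ D, R (μ1.parD ν) (μ2.parD ν)) ∧
    (∀ L : Finset Chan, R (FinDist.locD L μ1) (FinDist.locD L μ2))

/-- The `𝒟`-diamond equivalence `=◇^𝒟`, the largest probabilistically equipollent
`𝒟`-extensional relation. -/
def DiamondEq (D : Set (FinDist Tm)) (μ1 μ2 : FinDist Tm) : Prop :=
  ∃ R, Equipollent R ∧ DExtensional D R ∧ R μ1 μ2

/-- The `𝒟`-box equivalence `=□^𝒟`, the largest probabilistically strongly
equipollent `𝒟`-extensional relation. -/
def BoxEq (D : Set (FinDist Tm)) (μ1 μ2 : FinDist Tm) : Prop :=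
  ∃ R, StronglyEquipollent R ∧ DExtensional D R ∧ R μ1 μ2

/-! ## Probabilistic strong bisimulation and lifting -/

/-- Lifting of a relation on processes to distributions, matching the decomposition
`ρ1 = Σ_i p_i δ_{A_i}`, `ρ2 = Σ_i p_i δ_{B_i}` with `A_i R B_i`. -/
def RelLift (R : Tm → Tm → Prop) (ρ1 ρ2 : FinDist Tm) : Prop :=
  ∃ (k : ℕ) (p : Fin (k+1) → ℝ) (A B : Fin (k+1) → Tm),
    (∀ i, 0 ≤ p i) ∧
    (∀ Q, ρ1.toFun Q = ∑ i, if A i = Q then p i else 0) ∧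
    (∀ Q, ρ2.toFun Q = ∑ i, if B i = Q then p i else 0) ∧
    (∀ i, R (A i) (B i))

/-- `R` is a probabilistic strong bisimulation. -/
def IsStrongBisim (R : Tm → Tm → Prop) : Prop :=
  ∀ P Q, R P Q →
    (∀ α ρ, Step P α ρ → ∃ ρ', Step Q α ρ' ∧ RelLift R ρ ρ') ∧
    (∀ α ρ, Step Q α ρ → ∃ ρ', Step P α ρ' ∧ RelLift R ρ ρ')

/-- `∼p`, the largest probabilistic strong bisimulation. -/
def StrongBisim (P Q : Tm) : Prop := ∃ R, IsStrongBisim R ∧ R P Q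

/-- Lifting `E†` of an equivalence on processes to distributions: agreement on the
mass of every equivalence class. -/
def EqLift (E : Tm → Tm → Prop) (μ1 μ2 : FinDist Tm) : Prop :=
  ∀ P, μ1.mass {Q | E P Q} = μ2.mass {Q | E P Q}

/-- Single-branch prefix `α.T`. -/
def Tm.prefix1 (α : Act) (T : Tm) : Tm := Tm.sum 0 (fun _ => α) (fun _ => T)

/-- The process `τ.a` (i.e. `τ.a.0`). -/
def tauA (a : Chan) : Tm := Tm.prefix1 .tau (Tm.prefix1 (.inp a) .nil)

/-- The divergent process `μX.τ.X`. -/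
def diverge : Tm := Tm.fix (Tm.prefix1 .tau (.var 0))

/-- The process `τ.a + τ.(μX.τ.X)`. -/
def tauAOrDiverge (a : Chan) : Tm :=
  Tm.sum 1 (fun _ => .tau)
    (fun i => if (i : ℕ) = 0 then Tm.prefix1 (.inp a) .nil else diverge)

namespace FinDist

/-- Expectation of a real function under a finitely supported distribution. -/
noncomputable def ex {α : Type} (μ : FinDist α) (f : α → ℝ) : ℝ :=
  ∑ a ∈ μ.finite_support.toFinset, μ.toFun a * f a

theorem ex_eq {α : Type} (μ : FinDist α) (f : α → ℝ) (s : Finset α)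
    (h : ∀ a, μ.toFun a ≠ 0 → a ∈ s) : μ.ex f = ∑ a ∈ s, μ.toFun a * f a := by
  unfold ex
  apply Finset.sum_subset
  · intro a ha
    exact h a (by simpa using ha)
  · intro a _ ha
    have : μ.toFun a = 0 := by simpa using ha
    simp [this]

theorem ext' {α : Type} {μ ν : FinDist α} (h : ∀ a, μ.toFun a = ν.toFun a) : μ = ν := by
  cases μ; cases ν
  have := funext h
  simp only at this
  subst this
  rfl

theorem ex_single {α : Type} (μ : FinDist α) (a : α) (c : ℝ) :
    μ.ex (fun x => if x = a then c else 0) = μ.toFun a * c := by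
  rw [ex_eq μ _ (insert a μ.finite_support.toFinset) (by intro b hb; simp [hb])]
  rw [Finset.sum_eq_single a]
  · simp
  · intro b _ hb; simp [hb]
  · simp

theorem ext_ex {α : Type} {μ ν : FinDist α} (h : ∀ f, μ.ex f = ν.ex f) : μ = ν := by
  apply ext'
  intro a
  have := h (fun x => if x = a then 1 else 0)
  simpa [ex_single] using this

theorem ex_const {α : Type} (μ : FinDist α) (c : ℝ) : μ.ex (fun _ => c) = c := by
  unfold ex
  rw [← Finset.sum_mul, ← finsum_eq_sum μ.toFun μ.finite_support, μ.sum_one, one_mul]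

theorem ex_mono {α : Type} (μ : FinDist α) {f g : α → ℝ}
    (h : ∀ a, μ.toFun a ≠ 0 → f a ≤ g a) : μ.ex f ≤ μ.ex g := by
  unfold ex
  apply Finset.sum_le_sum
  intro a ha
  exact mul_le_mul_of_nonneg_left (h a (by simpa using ha)) (μ.nonneg a)

theorem ex_congr {α : Type} (μ : FinDist α) {f g : α → ℝ}
    (h : ∀ a, μ.toFun a ≠ 0 → f a = g a) : μ.ex f = μ.ex g :=
  le_antisymm (μ.ex_mono fun a ha => (h a ha).le) (μ.ex_mono fun a ha => (h a ha).ge)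

theorem ex_add {α : Type} (μ : FinDist α) (f g : α → ℝ) :
    μ.ex (fun a => f a + g a) = μ.ex f + μ.ex g := by
  unfold ex
  rw [← Finset.sum_add_distrib]
  exact Finset.sum_congr rfl fun a _ => by ring

theorem ex_sub {α : Type} (μ : FinDist α) (f g : α → ℝ) :
    μ.ex (fun a => f a - g a) = μ.ex f - μ.ex g := by
  unfold ex
  rw [← Finset.sum_sub_distrib]
  exact Finset.sum_congr rfl fun a _ => by ring

theorem ex_dirac {α : Type} (P : α) (f : α → ℝ) : (dirac P).ex f = f P := by
  rw [ex_eq _ _ {P} (by intro a ha; by_contra h; simp [dirac] at ha h; exact h ha)]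
  simp [dirac]

theorem map_apply {α β : Type} (g : α → β) (μ : FinDist α) (b : β) :
    (μ.map g).toFun b = μ.ex (fun a => if g a = b then 1 else 0) := by
  show (∑ᶠ a ∈ {a | g a = b}, μ.toFun a) = _
  rw [finsum_mem_eq_sum_of_inter_support_eq (t := μ.finite_support.toFinset.filter (fun a => g a = b))]
  · unfold ex
    rw [Finset.sum_filter]
    exact Finset.sum_congr rfl fun a _ => by simp
  · ext a
    simp only [Set.mem_inter_iff, Set.mem_setOf_eq, Finset.coe_filter,
      Set.Finite.mem_toFinset, Function.mem_support]
    tauto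

theorem map_supp {α β : Type} (g : α → β) (μ : FinDist α) (b : β)
    (h : (μ.map g).toFun b ≠ 0) : ∃ a, μ.toFun a ≠ 0 ∧ g a = b := by
  by_contra hc
  push Not at hc
  apply h
  rw [map_apply, ex_congr μ (g := fun _ => 0) (fun a ha => by simp [hc a ha]), ex_const]

theorem ex_map {α β : Type} (g : α → β) (μ : FinDist α) (f : β → ℝ) :
    (μ.map g).ex f = μ.ex (fun a => f (g a)) := by
  rw [ex_eq _ _ (μ.finite_support.toFinset.image g)]
  · unfold ex
    rw [← Finset.sum_fiberwise_of_maps_to (t := μ.finite_support.toFinset.image g)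
      (fun a ha => Finset.mem_image_of_mem g ha)]
    refine Finset.sum_congr rfl fun b _ => ?_
    rw [map_apply]
    unfold ex
    rw [Finset.sum_mul, Finset.sum_filter]
    refine Finset.sum_congr rfl fun a _ => ?_
    by_cases h : g a = b <;> simp [h]
  · intro b hb
    obtain ⟨a, ha, rfl⟩ := map_supp g μ b hb
    exact Finset.mem_image_of_mem g (by simpa using ha)

theorem ex_prod {α β : Type} (μ : FinDist α) (ν : FinDist β) (f : α × β → ℝ) :
    (μ.prod ν).ex f = μ.ex (fun a => ν.ex (fun b => f (a, b))) := by
  rw [ex_eq _ _ (μ.finite_support.toFinset ×ˢ ν.finite_support.toFinset)]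
  · unfold ex
    rw [Finset.sum_product]
    refine Finset.sum_congr rfl fun a _ => ?_
    rw [Finset.mul_sum]
    refine Finset.sum_congr rfl fun b _ => ?_
    simp only [prod]; ring
  · intro x hx
    have := mul_ne_zero_iff.mp hx
    simpa using this

theorem ex_parD (μ ν : FinDist Tm) (f : Tm → ℝ) :
    (μ.parD ν).ex f = μ.ex (fun a => ν.ex (fun b => f (Tm.par a b))) := by
  rw [parD, ex_map, ex_prod]

theorem ex_locD (L : Finset Chan) (μ : FinDist Tm) (f : Tm → ℝ) :
    (locD L μ).ex f = μ.ex (fun a => f (Tm.loc L a)) := by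
  rw [locD, ex_map]

theorem parD_supp (μ ν : FinDist Tm) (Q : Tm) (h : (μ.parD ν).toFun Q ≠ 0) :
    ∃ a b, μ.toFun a ≠ 0 ∧ ν.toFun b ≠ 0 ∧ Q = Tm.par a b := by
  obtain ⟨x, hx, rfl⟩ := map_supp _ _ _ h
  have := mul_ne_zero_iff.mp hx
  exact ⟨x.1, x.2, this.1, this.2, rfl⟩

theorem locD_supp (L : Finset Chan) (μ : FinDist Tm) (Q : Tm) (h : (locD L μ).toFun Q ≠ 0) :
    ∃ a, μ.toFun a ≠ 0 ∧ Q = Tm.loc L a := by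
  obtain ⟨x, hx, rfl⟩ := map_supp _ _ _ h
  exact ⟨x, hx, rfl⟩

theorem dirac_supp {α : Type} (P Q : α) (h : (dirac P).toFun Q ≠ 0) : Q = P := by
  by_contra hc; exact h (by simp [dirac, hc])

theorem mass_eq {α : Type} (μ : FinDist α) (φ : Set α) :
    μ.mass φ = μ.ex (fun a => if a ∈ φ then 1 else 0) := by
  unfold mass
  rw [finsum_mem_eq_sum_of_inter_support_eq (t := μ.finite_support.toFinset.filter (fun a => a ∈ φ))]
  · unfold ex
    rw [Finset.sum_filter]
    exact Finset.sum_congr rfl fun a _ => by simp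
  · ext a
    simp only [Set.mem_inter_iff, Finset.coe_filter, Set.mem_setOf_eq,
      Set.Finite.mem_toFinset, Function.mem_support]
    tauto

/-- Monadic bind of finitely supported distributions. -/
noncomputable def bind {α β : Type} (μ : FinDist α) (k : α → FinDist β) : FinDist β where
  toFun := fun b => μ.ex (fun a => (k a).toFun b)
  nonneg := fun b => by
    have := μ.ex_mono (f := fun _ => 0) (g := fun a => (k a).toFun b) (fun a _ => (k a).nonneg b)
    rwa [ex_const] at this
  finite_support := by
    apply Set.Finite.subset (μ.finite_support.biUnion
      (t := fun a => Function.support (k a).toFun) (fun a _ => (k a).finite_support))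
    intro b hb
    by_contra hc
    apply hb
    simp only [Set.mem_iUnion, Function.mem_support, not_exists, not_not] at hc
    show μ.ex _ = 0
    rw [ex_congr μ (g := fun _ => 0) (fun a ha => hc a ha), ex_const]
  sum_one := by
    set s := μ.finite_support.toFinset.biUnion (fun a => (k a).finite_support.toFinset) with hs
    have hk : ∀ a ∈ μ.finite_support.toFinset, ∑ b ∈ s, (k a).toFun b = 1 := by
      intro a ha
      have h1 := (k a).ex_const 1
      rw [ex_eq _ _ s] at h1
      · simpa using h1
      · intro b hb
        rw [hs, Finset.mem_biUnion]
        exact ⟨a, ha, by simpa using hb⟩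
    rw [finsum_eq_sum_of_support_subset (s := s)]
    · unfold ex
      rw [Finset.sum_comm]
      have h1 := μ.ex_const 1
      unfold ex at h1
      rw [← h1]
      refine Finset.sum_congr rfl fun a ha => ?_
      rw [← Finset.mul_sum, hk a ha]
    · intro b hb
      by_contra hc
      apply hb
      show μ.ex _ = 0
      rw [ex_congr μ (g := fun _ => 0), ex_const]
      intro a ha
      by_contra hd
      apply hc
      simp only [hs, Finset.coe_biUnion, Set.mem_iUnion, Finset.mem_coe, Set.Finite.mem_toFinset,
        Function.mem_support]
      exact ⟨a, ha, hd⟩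

theorem ex_bind {α β : Type} (μ : FinDist α) (k : α → FinDist β) (f : β → ℝ) :
    (μ.bind k).ex f = μ.ex (fun a => (k a).ex f) := by
  set s := (μ.bind k).finite_support.toFinset ∪
    μ.finite_support.toFinset.biUnion (fun a => (k a).finite_support.toFinset) with hs
  rw [ex_eq _ _ s (by intro b hb; simp [hs, hb])]
  have hk : ∀ a ∈ μ.finite_support.toFinset, (k a).ex f = ∑ b ∈ s, (k a).toFun b * f b := by
    intro a ha
    apply ex_eq
    intro b hb
    rw [hs, Finset.mem_union, Finset.mem_biUnion]
    exact Or.inr ⟨a, ha, by simpa using hb⟩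
  calc ∑ b ∈ s, (μ.bind k).toFun b * f b
      = ∑ b ∈ s, ∑ a ∈ μ.finite_support.toFinset, μ.toFun a * (k a).toFun b * f b := by
        refine Finset.sum_congr rfl fun b _ => ?_
        simp only [bind, ex]
        rw [Finset.sum_mul]
    _ = ∑ a ∈ μ.finite_support.toFinset, ∑ b ∈ s, μ.toFun a * (k a).toFun b * f b :=
        Finset.sum_comm
    _ = _ := by
        unfold ex
        refine Finset.sum_congr rfl fun a ha => ?_
        have := hk a ha
        unfold ex at this
        dsimp only
        rw [this, Finset.mul_sum]
        exact Finset.sum_congr rfl fun b _ => by ring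

theorem exists_mid {α : Type} (b : α → ℝ) (q : ℝ) (hb : ∀ x, 0 ≤ b x) (hq : 0 < q)
    (μ ρ ρ1 : FinDist α) (h : ∀ x, μ.toFun x = b x + q * ρ.toFun x) :
    ∃ μ1 : FinDist α, ∀ x, μ1.toFun x = b x + q * ρ1.toFun x := by
  have hbs : (Function.support b).Finite := by
    apply μ.finite_support.subset
    intro x hx
    have h1 := hb x
    have h2 : 0 < b x := lt_of_le_of_ne h1 (Ne.symm hx)
    have h3 := mul_nonneg hq.le (ρ.nonneg x)
    rw [Function.mem_support, h x]
    linarith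
  have hsum : ∀ ρ : FinDist α, ∑ᶠ x, (b x + q * ρ.toFun x) = (∑ᶠ x, b x) + q := by
    intro ρ
    rw [finsum_add_distrib hbs, ← mul_finsum, ρ.sum_one, mul_one]
    apply ρ.finite_support.subset
    intro x hx
    exact fun h0 => hx (by simp [h0])
  refine ⟨⟨fun x => b x + q * ρ1.toFun x, fun x => ?_, ?_, ?_⟩, fun x => rfl⟩
  · exact add_nonneg (hb x) (mul_nonneg hq.le (ρ1.nonneg x))
  · apply (hbs.union ρ1.finite_support).subset
    intro x hx
    by_contra hc
    simp only [Set.mem_union, Function.mem_support, not_or, not_not] at hc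
    exact hx (by simp [hc.1, hc.2])
  · rw [hsum, ← hsum ρ, ← μ.sum_one]
    exact finsum_congr fun x => (h x).symm

end FinDist

open FinDist

theorem Internal.refl (μ : FinDist Tm) : Internal μ μ := ⟨[], by simp, rfl⟩

theorem Internal.head {μ μ1 ν : FinDist Tm} {p : ℝ} (h : PStep μ .tau p μ1) (h1 : Internal μ1 ν) :
    Internal μ ν := by
  obtain ⟨π, hπ, hs⟩ := h1
  exact ⟨(.tau, p) :: π, by simpa using hπ, μ1, h, hs⟩

theorem Internal.ind {C : FinDist Tm → FinDist Tm → Prop} (h0 : ∀ μ, C μ μ)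
    (h1 : ∀ μ μ1 ν p, PStep μ .tau p μ1 → C μ1 ν → C μ ν) {μ ν : FinDist Tm}
    (h : Internal μ ν) : C μ ν := by
  obtain ⟨π, hπ, hs⟩ := h
  induction π generalizing μ with
  | nil => have : ν = μ := hs
           subst this; exact h0 _
  | cons s π ih =>
    obtain ⟨μ1, hp, hs⟩ := hs
    have : s.1 = Act.tau := hπ s (by simp)
    rw [this] at hp
    exact h1 _ _ _ _ hp (ih (fun t ht => hπ t (by simp [ht])) hs)

theorem Internal.trans {μ ν ξ : FinDist Tm} (h : Internal μ ν) (h' : Internal ν ξ) :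
    Internal μ ξ :=
  Internal.ind (C := fun μ ν => Internal ν ξ → Internal μ ξ) (fun _ h => h)
    (fun _ _ _ _ hp ih h => Internal.head hp (ih h)) h h'

theorem Internal.step {P : Tm} {ρ : FinDist Tm} (h : Step P .tau ρ) : Internal (dirac P) ρ := by
  refine Internal.head (p := 1) (μ1 := ρ) ⟨one_pos, le_refl _, P, ρ, ?_, h, ?_⟩ (Internal.refl _)
  · simp [dirac]
  · intro Q; simp [dirac]

theorem Internal.convex {ρ ρ' : FinDist Tm} (h : Internal ρ ρ') (b : Tm → ℝ) (q : ℝ)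
    (hb : ∀ x, 0 ≤ b x) (hq : 0 < q) (μ μ' : FinDist Tm)
    (hμ : ∀ x, μ.toFun x = b x + q * ρ.toFun x)
    (hμ' : ∀ x, μ'.toFun x = b x + q * ρ'.toFun x) : Internal μ μ' := by
  revert μ μ'
  refine Internal.ind (C := fun ρ ρ' => ∀ μ μ' : FinDist Tm,
    (∀ x, μ.toFun x = b x + q * ρ.toFun x) → (∀ x, μ'.toFun x = b x + q * ρ'.toFun x) →
      Internal μ μ') ?_ ?_ h
  · intro ρ μ μ' h1 h2
    have : μ = μ' := ext' fun x => by rw [h1, h2]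
    rw [this]; exact Internal.refl _
  · intro ρ ρ1 ρ' p hp ih μ μ' h1 h2
    obtain ⟨μ1, hμ1⟩ := exists_mid b q hb hq μ ρ ρ1 h1
    obtain ⟨hp0, hp1, P, σ, hP, hst, hρ1⟩ := hp
    have hqP : 0 < q * ρ.toFun P := mul_pos hq hP
    have hle : q * ρ.toFun P ≤ μ.toFun P := by rw [h1]; linarith [hb P]
    have hμP : 0 < μ.toFun P := lt_of_lt_of_le hqP hle
    refine Internal.head (p := q * ρ.toFun P * p / μ.toFun P) (μ1 := μ1)
      ⟨by positivity, ?_, P, σ, hμP, hst, ?_⟩ (ih μ1 μ' hμ1 h2)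
    · rw [div_le_one hμP]
      nlinarith
    · intro Q
      rw [mul_div_cancel₀ _ hμP.ne', hμ1, hρ1, h1]
      ring

theorem Internal.bind (μ : FinDist Tm) (k : Tm → FinDist Tm)
    (hk : ∀ P, Internal (dirac P) (k P)) : Internal μ (μ.bind k) := by
  have key : ∀ s : Finset Tm, Internal μ (μ.bind (fun P => if P ∈ s then k P else dirac P)) := by
    intro s
    induction s using Finset.induction_on with
    | empty =>
      have : μ.bind (fun P => if P ∈ (∅ : Finset Tm) then k P else dirac P) = μ := by
        apply ext_ex; intro f; simp [ex_bind, ex_dirac]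
      rw [this]; exact Internal.refl _
    | insert P s hP ih =>
      refine ih.trans ?_
      have hsplit : ∀ (k' : Tm → FinDist Tm) (Q : Tm), (μ.bind k').toFun Q =
          μ.ex (fun P' => if P' = P then 0 else (k' P').toFun Q) + μ.toFun P * (k' P).toFun Q := by
        intro k' Q
        rw [← ex_single, ← ex_add]
        show μ.ex _ = _
        apply ex_congr
        intro a _
        by_cases h : a = P <;> simp [h]
      have hcongr : ∀ Q, μ.ex (fun P' => if P' = P then 0 else
            (if P' ∈ insert P s then k P' else dirac P').toFun Q) =
          μ.ex (fun P' => if P' = P then 0 else (if P' ∈ s then k P' else dirac P').toFun Q) := by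
        intro Q
        apply ex_congr
        intro a _
        by_cases h : a = P <;> simp [h]
      rcases (μ.nonneg P).eq_or_lt with h0 | h0
      · have : μ.bind (fun P' => if P' ∈ insert P s then k P' else dirac P') =
            μ.bind (fun P' => if P' ∈ s then k P' else dirac P') := by
          apply ext'
          intro Q
          rw [hsplit, hsplit, hcongr, ← h0]; simp
        rw [this]; exact Internal.refl _
      · refine Internal.convex (hk P)
          (fun Q => μ.ex (fun P' => if P' = P then 0 else
            (if P' ∈ s then k P' else dirac P').toFun Q)) (μ.toFun P) ?_ h0 _ _ ?_ ?_
        · intro Q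
          have := μ.ex_mono (f := fun _ => 0) (g := fun P' => if P' = P then 0 else
            (if P' ∈ s then k P' else dirac P').toFun Q) (by
              intro a _
              try dsimp only
              split_ifs
              · exact le_refl _
              · exact FinDist.nonneg _ _
              · exact FinDist.nonneg _ _)
          rwa [ex_const] at this
        · intro Q
          rw [hsplit]; simp [hP]
        · intro Q
          rw [hsplit, hcongr]; simp
  have := key μ.finite_support.toFinset
  convert this using 1
  apply ext_ex
  intro f
  rw [ex_bind, ex_bind]
  apply ex_congr
  intro a ha
  simp [ha]

theorem PStep.ex {μ ν : FinDist Tm} {α : Act} {p : ℝ} (h : PStep μ α p ν) (f : Tm → ℝ) :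
    ∃ (P : Tm) (ρ : FinDist Tm) (c : ℝ), 0 ≤ c ∧ Step P α ρ ∧
      ν.ex f = μ.ex f + c * (ρ.ex f - f P) := by
  obtain ⟨hp0, hp1, P, ρ, hP, hst, hν⟩ := h
  refine ⟨P, ρ, μ.toFun P * p, by positivity, hst, ?_⟩
  set s := insert P (μ.finite_support.toFinset ∪ ν.finite_support.toFinset ∪
    ρ.finite_support.toFinset) with hs
  rw [ex_eq μ f s (by intro a ha; simp [hs, ha]), ex_eq ν f s (by intro a ha; simp [hs, ha]),
    ex_eq ρ f s (by intro a ha; simp [hs, ha])]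
  have h1 : f P = ∑ a ∈ s, (if a = P then 1 else 0) * f a := by
    rw [Finset.sum_eq_single P]
    · simp
    · intro b _ hb; simp [hb]
    · intro h; exact absurd (Finset.mem_insert_self _ _) h
  rw [h1, ← Finset.sum_sub_distrib, Finset.mul_sum, ← Finset.sum_add_distrib]
  refine Finset.sum_congr rfl fun a _ => ?_
  rw [hν a]; ring

theorem Internal.super {μ ν : FinDist Tm} (h : Internal μ ν) (f : Tm → ℝ)
    (hf : ∀ P ρ, Step P .tau ρ → ρ.ex f ≤ f P) : ν.ex f ≤ μ.ex f := by
  refine Internal.ind (C := fun μ ν => ν.ex f ≤ μ.ex f) (fun _ => le_refl _) ?_ h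
  intro μ μ1 ν p hp ih
  obtain ⟨P, ρ, c, hc, hst, he⟩ := hp.ex f
  have := hf P ρ hst
  nlinarith

theorem Internal.sub {μ ν : FinDist Tm} (h : Internal μ ν) (f : Tm → ℝ)
    (hf : ∀ P ρ, Step P .tau ρ → f P ≤ ρ.ex f) : μ.ex f ≤ ν.ex f := by
  refine Internal.ind (C := fun μ ν => μ.ex f ≤ ν.ex f) (fun _ => le_refl _) ?_ h
  intro μ μ1 ν p hp ih
  obtain ⟨P, ρ, c, hc, hst, he⟩ := hp.ex f
  have := hf P ρ hst
  nlinarith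

/-- The may value of a single term. -/
noncomputable def Vm (P : Tm) : ℝ := chiMayL (dirac P)

/-- The fair value of a single term. -/
noncomputable def Vf (P : Tm) : ℝ := chiFairL (dirac P)

theorem mass_le_one (μ : FinDist Tm) : μ.mass psiL ≤ 1 := by
  rw [mass_eq]
  have := μ.ex_mono (f := fun a => if a ∈ psiL then (1 : ℝ) else 0) (g := fun _ => 1)
    (by intro a _; split_ifs <;> norm_num)
  rwa [ex_const] at this

theorem mass_nonneg (μ : FinDist Tm) : 0 ≤ μ.mass psiL := by
  rw [mass_eq]
  have := μ.ex_mono (f := fun _ => 0) (g := fun a => if a ∈ psiL then (1 : ℝ) else 0)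
    (by intro a _; split_ifs <;> norm_num)
  rwa [ex_const] at this

theorem may_bdd (μ : FinDist Tm) : BddAbove {x | ∃ ν, Internal μ ν ∧ x = ν.mass psiL} :=
  ⟨1, by rintro x ⟨ν, _, rfl⟩; exact mass_le_one ν⟩

theorem may_ge {μ ν : FinDist Tm} (h : Internal μ ν) : ν.mass psiL ≤ chiMayL μ :=
  le_csSup (may_bdd μ) ⟨ν, h, rfl⟩

theorem may_mono {μ ν : FinDist Tm} (h : Internal μ ν) : chiMayL ν ≤ chiMayL μ :=
  csSup_le ⟨_, ν, Internal.refl _, rfl⟩ (by rintro x ⟨ξ, hξ, rfl⟩; exact may_ge (h.trans hξ))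

theorem may_le_one (μ : FinDist Tm) : chiMayL μ ≤ 1 :=
  csSup_le ⟨_, μ, Internal.refl _, rfl⟩ (by rintro x ⟨ν, _, rfl⟩; exact mass_le_one ν)

theorem may_nonneg (μ : FinDist Tm) : 0 ≤ chiMayL μ :=
  (mass_nonneg μ).trans (may_ge (Internal.refl μ))

theorem may_le_pot (μ : FinDist Tm) (f : Tm → ℝ) (h0 : ∀ P, 0 ≤ f P) (h1 : ∀ P ∈ psiL, 1 ≤ f P)
    (hf : ∀ P ρ, Step P .tau ρ → ρ.ex f ≤ f P) : chiMayL μ ≤ μ.ex f := by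
  refine csSup_le ⟨_, μ, Internal.refl _, rfl⟩ ?_
  rintro x ⟨ν, hν, rfl⟩
  refine le_trans ?_ (hν.super f hf)
  rw [mass_eq]
  apply ex_mono
  intro a _
  try dsimp only
  split_ifs with h
  · exact h1 a h
  · exact h0 a

theorem may_ge_ex (μ : FinDist Tm) : μ.ex Vm ≤ chiMayL μ := by
  apply le_of_forall_pos_le_add
  intro ε hε
  have : ∀ P, ∃ ν, Internal (dirac P) ν ∧ Vm P - ε < ν.mass psiL := by
    intro P
    obtain ⟨x, ⟨ν, hν, rfl⟩, hx⟩ := exists_lt_of_lt_csSup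
      (s := {x | ∃ ν, Internal (dirac P) ν ∧ x = ν.mass psiL})
      ⟨_, dirac P, Internal.refl _, rfl⟩ (sub_lt_self (Vm P) hε)
    exact ⟨ν, hν, hx⟩
  choose k hk hlt using this
  have h1 := may_ge (Internal.bind μ k hk)
  rw [mass_eq, ex_bind] at h1
  have h2 := μ.ex_mono (f := fun P => Vm P - ε) (g := fun P => (k P).ex
    (fun a => if a ∈ psiL then (1 : ℝ) else 0)) (by
      intro a _
      have := hlt a
      rw [mass_eq] at this
      exact this.le)
  rw [ex_sub, ex_const] at h2
  linarith

theorem Vm_nonneg (P : Tm) : 0 ≤ Vm P := may_nonneg _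
theorem Vm_le_one (P : Tm) : Vm P ≤ 1 := may_le_one _

theorem Vm_psi {P : Tm} (h : P ∈ psiL) : 1 ≤ Vm P := by
  have := may_ge (Internal.refl (dirac P))
  rw [mass_eq, ex_dirac, if_pos h] at this
  exact this

theorem Vm_step {P : Tm} {ρ : FinDist Tm} (h : Step P .tau ρ) : ρ.ex Vm ≤ Vm P :=
  (may_ge_ex ρ).trans (may_mono (Internal.step h))

theorem may_eq (μ : FinDist Tm) : chiMayL μ = μ.ex Vm :=
  le_antisymm (may_le_pot μ Vm Vm_nonneg (fun _ => Vm_psi) (fun _ _ => Vm_step)) (may_ge_ex μ)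

theorem Vm_le_pot (P : Tm) (f : Tm → ℝ) (h0 : ∀ P, 0 ≤ f P) (h1 : ∀ P ∈ psiL, 1 ≤ f P)
    (hf : ∀ P ρ, Step P .tau ρ → ρ.ex f ≤ f P) : Vm P ≤ f P := by
  have := may_le_pot (dirac P) f h0 h1 hf
  rwa [ex_dirac] at this

theorem fair_bdd (μ : FinDist Tm) : BddBelow {x | ∃ ν, Internal μ ν ∧ x = chiMayL ν} :=
  ⟨0, by rintro x ⟨ν, _, rfl⟩; exact may_nonneg ν⟩

theorem fair_le {μ ν : FinDist Tm} (h : Internal μ ν) : chiFairL μ ≤ chiMayL ν :=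
  csInf_le (fair_bdd μ) ⟨ν, h, rfl⟩

theorem fair_mono {μ ν : FinDist Tm} (h : Internal μ ν) : chiFairL μ ≤ chiFairL ν :=
  le_csInf ⟨_, ν, Internal.refl _, rfl⟩ (by rintro x ⟨ξ, hξ, rfl⟩; exact fair_le (h.trans hξ))

theorem fair_nonneg (μ : FinDist Tm) : 0 ≤ chiFairL μ :=
  le_csInf ⟨_, μ, Internal.refl _, rfl⟩ (by rintro x ⟨ξ, hξ, rfl⟩; exact may_nonneg ξ)

theorem pot_le_fair (μ : FinDist Tm) (g : Tm → ℝ) (h1 : ∀ P, g P ≤ Vm P)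
    (hg : ∀ P ρ, Step P .tau ρ → g P ≤ ρ.ex g) : μ.ex g ≤ chiFairL μ := by
  refine le_csInf ⟨_, μ, Internal.refl _, rfl⟩ ?_
  rintro x ⟨ν, hν, rfl⟩
  rw [may_eq]
  exact (hν.sub g hg).trans (ex_mono _ fun a _ => h1 a)

theorem fair_le_ex (μ : FinDist Tm) : chiFairL μ ≤ μ.ex Vf := by
  apply le_of_forall_pos_le_add
  intro ε hε
  have : ∀ P, ∃ ν, Internal (dirac P) ν ∧ chiMayL ν < Vf P + ε := by
    intro P
    obtain ⟨x, ⟨ν, hν, rfl⟩, hx⟩ := exists_lt_of_csInf_lt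
      (s := {x | ∃ ν, Internal (dirac P) ν ∧ x = chiMayL ν})
      ⟨_, dirac P, Internal.refl _, rfl⟩ (lt_add_of_pos_right (Vf P) hε)
    exact ⟨ν, hν, hx⟩
  choose k hk hlt using this
  have h1 := fair_le (Internal.bind μ k hk)
  rw [may_eq, ex_bind] at h1
  have h2 := μ.ex_mono (g := fun P => Vf P + ε) (f := fun P => (k P).ex Vm) (by
      intro a _
      have := hlt a
      rw [may_eq] at this
      exact this.le)
  rw [ex_add, ex_const] at h2
  linarith

theorem Vf_step {P : Tm} {ρ : FinDist Tm} (h : Step P .tau ρ) : Vf P ≤ ρ.ex Vf :=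
  (fair_mono (Internal.step h)).trans (fair_le_ex ρ)

theorem Vf_nonneg (P : Tm) : 0 ≤ Vf P := fair_nonneg _

theorem Vf_le_Vm (P : Tm) : Vf P ≤ Vm P := fair_le (Internal.refl _)

/-! ### Inversion of steps -/

theorem step_sum_inv {k : ℕ} {acts : Fin (k+1) → Act} {conts : Fin (k+1) → Tm} {α : Act}
    {ρ : FinDist Tm} (h : Step (.sum k acts conts) α ρ) :
    ∃ i, α = acts i ∧ ρ = dirac (conts i) := by
  cases h with
  | choice _ _ i => exact ⟨i, rfl, rfl⟩

theorem step_pfx_inv {β : Act} {T : Tm} {α : Act} {ρ : FinDist Tm}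
    (h : Step (Tm.prefix1 β T) α ρ) : α = β ∧ ρ = dirac T := by
  obtain ⟨i, h1, h2⟩ := step_sum_inv h
  exact ⟨h1, h2⟩

theorem step_pfx (β : Act) (T : Tm) : Step (Tm.prefix1 β T) β (dirac T) :=
  Step.choice (fun _ => β) (fun _ => T) 0

theorem step_nil_inv {α : Act} {ρ : FinDist Tm} (h : Step .nil α ρ) : False := by
  cases h

theorem step_loc_inv {L : Finset Chan} {S : Tm} {α : Act} {ρ : FinDist Tm}
    (h : Step (.loc L S) α ρ) :
    ∃ ρ', ρ = locD L ρ' ∧ Step S α ρ' ∧ Act.Allowed L α := by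
  cases h with
  | loc _ h1 h2 => exact ⟨_, rfl, h1, h2⟩

theorem step_par_inv {S T : Tm} {α : Act} {ρ : FinDist Tm} (h : Step (.par S T) α ρ) :
    (∃ σ, ρ = σ.parD (dirac T) ∧ Step S α σ) ∨
    (∃ σ, ρ = (dirac S).parD σ ∧ Step T α σ) ∨
    (∃ ℓ1 ℓ2 ρ1 ρ2, α = .tau ∧ Act.Comp ℓ1 ℓ2 ∧ Step S ℓ1 ρ1 ∧ Step T ℓ2 ρ2 ∧
      ρ = ρ1.parD ρ2) := by
  cases h with
  | parL _ h => exact Or.inl ⟨_, rfl, h⟩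
  | parR _ h => exact Or.inr (Or.inl ⟨_, rfl, h⟩)
  | comm hc h1 h2 => exact Or.inr (Or.inr ⟨_, _, _, _, rfl, hc, h1, h2, rfl⟩)

theorem step_diverge_inv {α : Act} {ρ : FinDist Tm} (h : Step diverge α ρ) :
    α = .tau ∧ ρ = dirac diverge := by
  cases h with
  | fixp h => exact step_pfx_inv (T := diverge) h

theorem step_tauA_inv {a : Chan} {α : Act} {ρ : FinDist Tm} (h : Step (tauA a) α ρ) :
    α = .tau ∧ ρ = dirac (Tm.prefix1 (.inp a) .nil) := step_pfx_inv h

theorem step_tauB_inv {a : Chan} {α : Act} {ρ : FinDist Tm} (h : Step (tauAOrDiverge a) α ρ) :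
    α = .tau ∧ (ρ = dirac (Tm.prefix1 (.inp a) .nil) ∨ ρ = dirac diverge) := by
  obtain ⟨i, h1, h2⟩ := step_sum_inv h
  refine ⟨h1, ?_⟩
  by_cases hi : (i : ℕ) = 0
  · left; simpa [hi] using h2
  · right; simpa [hi] using h2

theorem step_tauB_left (a : Chan) :
    Step (tauAOrDiverge a) .tau (dirac (Tm.prefix1 (.inp a) .nil)) :=
  Step.choice (fun _ => .tau)
    (fun i : Fin 2 => if (i : ℕ) = 0 then Tm.prefix1 (.inp a) .nil else diverge) 0

theorem step_tauB_right (a : Chan) :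
    Step (tauAOrDiverge a) .tau (dirac diverge) :=
  Step.choice (fun _ => .tau)
    (fun i : Fin 2 => if (i : ℕ) = 0 then Tm.prefix1 (.inp a) .nil else diverge) 1

/-! ### The two processes are not box equivalent -/

theorem prefix_inp_psi (a : Chan) (T : Tm) : Tm.prefix1 (.inp a) T ∈ psiL :=
  ⟨.inp a, _, trivial, step_pfx _ _⟩

theorem fair_tauA (a : Chan) : 1 ≤ Vf (tauA a) := by
  have h := pot_le_fair (dirac (tauA a))
    (fun P => if P = tauA a ∨ P = Tm.prefix1 (.inp a) .nil then 1 else 0) ?_ ?_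
  · rw [ex_dirac] at h
    simpa [Vf] using h
  · intro P
    try dsimp only
    split_ifs with hP
    · rcases hP with rfl | rfl
      · have := Vm_step (step_pfx .tau (Tm.prefix1 (.inp a) .nil))
        rw [ex_dirac] at this
        exact (Vm_psi (prefix_inp_psi a _)).trans this
      · exact Vm_psi (prefix_inp_psi a _)
    · exact Vm_nonneg P
  · intro P ρ hst
    try dsimp only
    split_ifs with hP
    · rcases hP with rfl | rfl
      · obtain ⟨_, rfl⟩ := step_tauA_inv hst
        rw [ex_dirac]; simp
      · have := (step_pfx_inv hst).1
        cases this
    · have := ρ.ex_mono (f := fun _ => 0)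
        (g := fun P => if P = tauA a ∨ P = Tm.prefix1 (.inp a) .nil then (1 : ℝ) else 0)
        (by intro x _; split_ifs <;> norm_num)
      rwa [ex_const] at this

theorem Vm_diverge : Vm diverge ≤ 0 := by
  have h := Vm_le_pot diverge (fun P => if P = diverge then 0 else 1) ?_ ?_ ?_
  · simpa using h
  · intro P; try dsimp only
    split_ifs <;> norm_num
  · rintro P ⟨α, ρ, hα, hst⟩
    try dsimp only
    split_ifs with hP
    · subst hP
      rw [(step_diverge_inv hst).1] at hα
      exact absurd hα id
    · exact le_refl _
  · intro P ρ hst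
    try dsimp only
    split_ifs with hP
    · subst hP
      rw [(step_diverge_inv hst).2, ex_dirac]; simp
    · have := ρ.ex_mono (g := fun _ => 1) (f := fun P => if P = diverge then (0 : ℝ) else 1)
        (by intro x _; split_ifs <;> norm_num)
      rwa [ex_const] at this

theorem fair_tauB (a : Chan) : Vf (tauAOrDiverge a) ≤ 0 := by
  have := Vf_step (step_tauB_right a)
  rw [ex_dirac] at this
  exact this.trans ((Vf_le_Vm _).trans Vm_diverge)

/-! ### The two processes are diamond equivalent -/

/-- Evaluation contexts. -/
inductive Ctx where
  | hole : Ctx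
  | par : Ctx → Tm → Ctx
  | loc : Finset Chan → Ctx → Ctx

/-- Plugging a term into a context. -/
def Ctx.plug (X : Tm) : Ctx → Tm
  | .hole => X
  | .par E Q => .par (Ctx.plug X E) Q
  | .loc L E => .loc L (Ctx.plug X E)

theorem ctx_step {Y Y' : Tm} (h : Step Y .tau (dirac Y')) (E : Ctx) :
    Step (E.plug Y) .tau (dirac (E.plug Y')) := by
  induction E with
  | hole => exact h
  | par E Q ih =>
    have := Step.parL Q ih
    have e : (dirac (E.plug Y')).parD (dirac Q) = dirac ((Ctx.par E Q).plug Y') := by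
      apply ext_ex; intro f; simp [ex_parD, ex_dirac, Ctx.plug]
    rwa [e] at this
  | loc L E ih =>
    have := Step.loc L ih (by trivial)
    have e : locD L (dirac (E.plug Y')) = dirac ((Ctx.loc L E).plug Y') := by
      apply ext_ex; intro f; simp [ex_locD, ex_dirac, Ctx.plug]
    rwa [e] at this

theorem ctx_step_inv {X : Tm}
    (hX : ∀ α ρ, Step X α ρ → α = .tau ∧ ∃ X', ρ = dirac X') (E : Ctx) {α : Act}
    {ρ : FinDist Tm} (h : Step (E.plug X) α ρ) :
    (∃ ω : FinDist Ctx, ρ = ω.map (Ctx.plug X) ∧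
      ∀ Z, Step (E.plug Z) α (ω.map (Ctx.plug Z))) ∨
    (α = .tau ∧ ∃ X', Step X .tau (dirac X') ∧ ρ = dirac (E.plug X')) := by
  induction E generalizing α ρ with
  | hole =>
    right
    obtain ⟨rfl, X', rfl⟩ := hX _ _ h
    exact ⟨rfl, X', h, rfl⟩
  | par E Q ih =>
    rcases step_par_inv h with ⟨σ, rfl, hσ⟩ | ⟨σ, rfl, hσ⟩ | ⟨ℓ1, ℓ2, ρ1, ρ2, rfl, hc, h1, h2, rfl⟩
    · rcases ih hσ with ⟨ω, rfl, hω⟩ | ⟨rfl, X', hX', rfl⟩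
      · left
        have e : ∀ Z, (ω.map (Ctx.plug Z)).parD (dirac Q) =
            (ω.map (fun E => Ctx.par E Q)).map (Ctx.plug Z) := by
          intro Z
          apply ext_ex; intro f; simp [ex_parD, ex_dirac, ex_map, Ctx.plug]
        refine ⟨ω.map (fun E => Ctx.par E Q), e X, fun Z => ?_⟩
        rw [← e]
        exact Step.parL Q (hω Z)
      · right
        refine ⟨rfl, X', hX', ?_⟩
        apply ext_ex; intro f; simp [ex_parD, ex_dirac, Ctx.plug]
    · left
      have e : ∀ Z, (dirac (E.plug Z)).parD σ = (σ.map (fun Q => Ctx.par E Q)).map (Ctx.plug Z) := by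
        intro Z
        apply ext_ex; intro f; simp [ex_parD, ex_dirac, ex_map, Ctx.plug]
      refine ⟨σ.map (fun Q => Ctx.par E Q), e X, fun Z => ?_⟩
      rw [← e]
      exact Step.parR _ hσ
    · rcases ih h1 with ⟨ω, rfl, hω⟩ | ⟨rfl, X', hX', rfl⟩
      · left
        have e : ∀ Z, (ω.map (Ctx.plug Z)).parD ρ2 =
            ((ω.prod ρ2).map (fun x => Ctx.par x.1 x.2)).map (Ctx.plug Z) := by
          intro Z
          apply ext_ex; intro f; simp [ex_parD, ex_map, ex_prod, Ctx.plug]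
        refine ⟨(ω.prod ρ2).map (fun x => Ctx.par x.1 x.2), e X, fun Z => ?_⟩
        rw [← e]
        exact Step.comm hc (hω Z) h2
      · obtain ⟨a, ⟨h, _⟩ | ⟨h, _⟩⟩ := hc <;> cases h
  | loc L E ih =>
    obtain ⟨σ, rfl, hσ, hal⟩ := step_loc_inv h
    rcases ih hσ with ⟨ω, rfl, hω⟩ | ⟨rfl, X', hX', rfl⟩
    · left
      have e : ∀ Z, locD L (ω.map (Ctx.plug Z)) =
          (ω.map (fun E => Ctx.loc L E)).map (Ctx.plug Z) := by
        intro Z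
        apply ext_ex; intro f; simp [ex_locD, ex_map, Ctx.plug]
      refine ⟨ω.map (fun E => Ctx.loc L E), e X, fun Z => ?_⟩
      rw [← e]
      exact Step.loc L (hω Z) hal
    · right
      refine ⟨rfl, X', hX', ?_⟩
      apply ext_ex; intro f; simp [ex_locD, ex_dirac, Ctx.plug]

theorem Vm_sim (S : Tm → Tm → Prop) (hrefl : ∀ P, S P P)
    (hpsi : ∀ P Q, S P Q → P ∈ psiL → 1 ≤ Vm Q)
    (hst : ∀ P Q ρ, S P Q → Step P .tau ρ → ∀ g : Tm → ℝ,
      (∀ P' Q', S P' Q' → g P' ≤ Vm Q') → ρ.ex g ≤ Vm Q)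
    {P Q : Tm} (h : S P Q) : Vm P ≤ Vm Q := by
  set f : Tm → ℝ := fun P => sInf {x | ∃ Q, S P Q ∧ x = Vm Q} with hf
  have hne : ∀ P, ({x | ∃ Q, S P Q ∧ x = Vm Q} : Set ℝ).Nonempty :=
    fun P => ⟨_, P, hrefl P, rfl⟩
  have hle : ∀ P Q, S P Q → f P ≤ Vm Q := fun P Q h =>
    csInf_le ⟨0, by rintro x ⟨Q, _, rfl⟩; exact Vm_nonneg Q⟩ ⟨Q, h, rfl⟩
  refine (Vm_le_pot P f ?_ ?_ ?_).trans (hle P Q h)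
  · intro P
    exact le_csInf (hne P) (by rintro x ⟨Q, _, rfl⟩; exact Vm_nonneg Q)
  · intro P hP
    exact le_csInf (hne P) (by rintro x ⟨Q, hQ, rfl⟩; exact hpsi P Q hQ hP)
  · intro P ρ hρ
    exact le_csInf (hne P) (by rintro x ⟨Q, hQ, rfl⟩; exact hst P Q ρ hQ hρ f hle)

theorem Vm_ctx (H : Tm → Tm → Prop)
    (hH : ∀ X Y, H X Y → ∀ α ρ, Step X α ρ → α = .tau ∧ ∃ X', ρ = dirac X' ∧
      (H X' Y ∨ Step Y .tau (dirac X')))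
    {X Y : Tm} (h : H X Y) (E : Ctx) : Vm (E.plug X) ≤ Vm (E.plug Y) := by
  refine Vm_sim (fun P Q => P = Q ∨ ∃ E X Y, H X Y ∧ P = Ctx.plug X E ∧ Q = Ctx.plug Y E)
    (fun P => Or.inl rfl) ?_ ?_ (Or.inr ⟨E, X, Y, h, rfl, rfl⟩)
  · rintro P Q (rfl | ⟨E, X, Y, h, rfl, rfl⟩) ⟨α, ρ, hα, hst⟩
    · exact Vm_psi ⟨α, ρ, hα, hst⟩
    · rcases ctx_step_inv (fun α ρ h1 => ⟨(hH X Y h α ρ h1).1, (hH X Y h α ρ h1).2.imp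
        fun _ h => h.1⟩) E hst with ⟨ω, rfl, hω⟩ | ⟨rfl, _⟩
      · exact Vm_psi ⟨α, _, hα, hω Y⟩
      · exact absurd hα id
  · rintro P Q ρ (rfl | ⟨E, X, Y, h, rfl, rfl⟩) hst g hg
    · exact (ex_mono _ fun a _ => hg a a (Or.inl rfl)).trans (Vm_step hst)
    · rcases ctx_step_inv (fun α ρ h1 => ⟨(hH X Y h α ρ h1).1, (hH X Y h α ρ h1).2.imp
        fun _ h => h.1⟩) E hst with ⟨ω, rfl, hω⟩ | ⟨_, X', hX', rfl⟩
      · refine le_trans ?_ (Vm_step (hω Y))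
        rw [ex_map, ex_map]
        exact ex_mono _ fun a _ => hg _ _ (Or.inr ⟨a, X, Y, h, rfl, rfl⟩)
      · rw [ex_dirac]
        obtain ⟨_, X'', he, hor⟩ := hH X Y h _ _ hX'
        have hXX : X' = X'' := by
          apply dirac_supp
          rw [← he]; simp [dirac]
        subst hXX
        rcases hor with hor | hor
        · exact hg _ _ (Or.inr ⟨E, X', Y, hor, rfl, rfl⟩)
        · have h2 := Vm_step (ctx_step hor E)
          rw [ex_dirac] at h2
          exact (hg _ _ (Or.inl rfl)).trans h2

theorem Vm_AB (a : Chan) (E : Ctx) :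
    Vm (E.plug (tauA a)) = Vm (E.plug (tauAOrDiverge a)) := by
  apply le_antisymm
  · refine Vm_ctx (fun X Y => X = tauA a ∧ Y = tauAOrDiverge a) ?_ ⟨rfl, rfl⟩ E
    rintro X Y ⟨rfl, rfl⟩ α ρ h
    obtain ⟨rfl, rfl⟩ := step_tauA_inv h
    exact ⟨rfl, _, rfl, Or.inr (step_tauB_left a)⟩
  · refine Vm_ctx (fun X Y => (X = tauAOrDiverge a ∨ X = diverge) ∧ Y = tauA a) ?_
      ⟨Or.inl rfl, rfl⟩ E
    rintro X Y ⟨rfl | rfl, rfl⟩ α ρ h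
    · obtain ⟨rfl, rfl | rfl⟩ := step_tauB_inv h
      · exact ⟨rfl, _, rfl, Or.inr (step_pfx _ _)⟩
      · exact ⟨rfl, _, rfl, Or.inl ⟨Or.inr rfl, rfl⟩⟩
    · obtain ⟨rfl, rfl⟩ := step_diverge_inv h
      exact ⟨rfl, _, rfl, Or.inl ⟨Or.inr rfl, rfl⟩⟩

theorem diamond_AB (D : Set (FinDist Tm)) (a : Chan) :
    DiamondEq D (dirac (tauA a)) (dirac (tauAOrDiverge a)) := by
  refine ⟨fun μ1 μ2 => ∃ ω : FinDist Ctx, μ1 = ω.map (Ctx.plug (tauA a)) ∧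
    μ2 = ω.map (Ctx.plug (tauAOrDiverge a)), ?_, ?_, ?_⟩
  · rintro _ _ ⟨ω, rfl, rfl⟩
    rw [may_eq, may_eq, ex_map, ex_map]
    exact ex_congr _ fun E _ => Vm_AB a E
  · rintro _ _ ⟨ω, rfl, rfl⟩
    refine ⟨fun ν _ => ⟨(ω.prod ν).map (fun x => Ctx.par x.1 x.2), ?_, ?_⟩,
      fun L => ⟨ω.map (Ctx.loc L), ?_, ?_⟩⟩ <;>
    · apply ext_ex; intro f; simp [ex_parD, ex_locD, ex_map, ex_prod, Ctx.plug]
  · refine ⟨dirac .hole, ?_, ?_⟩ <;>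
    · apply ext_ex; intro f; simp [ex_dirac, ex_map, Ctx.plug]

theorem not_box_AB (D : Set (FinDist Tm)) (a : Chan) :
    ¬ BoxEq D (dirac (tauA a)) (dirac (tauAOrDiverge a)) := by
  rintro ⟨R, hR, _, h⟩
  have h1 := hR _ _ h
  have h2 := fair_tauA a
  have h3 := fair_tauB a
  unfold Vf at h2 h3
  linarith

/-! ### Channels are preserved by steps -/

theorem chans_subst (P : Tm) (T : Tm) (n : ℕ) : (Tm.subst P n T).chans ⊆ P.chans ∪ T.chans := by
  induction T generalizing n with
  | nil => simp [Tm.subst, Tm.chans]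
  | var m =>
    simp only [Tm.subst]
    split_ifs
    · exact Finset.subset_union_left
    · simp [Tm.chans]
  | sum k a c ih =>
    simp only [Tm.subst, Tm.chans]
    intro x hx
    simp only [Finset.mem_union, Finset.mem_sup, Finset.mem_univ, true_and] at hx ⊢
    rcases hx with hx | ⟨i, hx⟩
    · exact Or.inr (Or.inl hx)
    · have := ih i n hx
      rw [Finset.mem_union] at this
      rcases this with h | h
      · exact Or.inl h
      · exact Or.inr (Or.inr ⟨i, h⟩)
  | oplus k w c ih =>
    simp only [Tm.subst, Tm.chans]
    intro x hx
    simp only [Finset.mem_union, Finset.mem_sup, Finset.mem_univ, true_and] at hx ⊢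
    obtain ⟨i, hx⟩ := hx
    have := ih i n hx
    rw [Finset.mem_union] at this
    rcases this with h | h
    · exact Or.inl h
    · exact Or.inr ⟨i, h⟩
  | par S T ih1 ih2 =>
    simp only [Tm.subst, Tm.chans]
    intro x hx
    rw [Finset.mem_union] at hx
    have h1 := @ih1 n x
    have h2 := @ih2 n x
    simp only [Finset.mem_union] at *
    tauto
  | loc L T ih =>
    simp only [Tm.subst, Tm.chans]
    intro x hx
    have h1 := @ih n x
    simp only [Finset.mem_union] at *
    tauto
  | fix T ih =>
    simp only [Tm.subst, Tm.chans]
    exact ih (n+1)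

theorem chans_step {P : Tm} {α : Act} {ρ : FinDist Tm} (h : Step P α ρ) :
    α.chans ⊆ P.chans ∧ ∀ Q, ρ.toFun Q ≠ 0 → Q.chans ⊆ P.chans := by
  induction h with
  | choice acts conts i =>
    simp only [Tm.chans]
    constructor
    · intro x hx
      simp only [Finset.mem_union, Finset.mem_sup, Finset.mem_univ, true_and]
      exact Or.inl ⟨i, hx⟩
    · intro Q hQ x hx
      rw [dirac_supp _ _ hQ] at hx
      simp only [Finset.mem_union, Finset.mem_sup, Finset.mem_univ, true_and]
      exact Or.inr ⟨i, hx⟩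
  | oplus w conts ρ hw hρ =>
    refine ⟨by simp [Act.chans], ?_⟩
    intro Q hQ x hx
    rw [hρ] at hQ
    obtain ⟨i, _, hi⟩ := Finset.exists_ne_zero_of_sum_ne_zero hQ
    simp only [Tm.chans, Finset.mem_sup, Finset.mem_univ, true_and]
    refine ⟨i, ?_⟩
    by_cases hc : conts i = Q
    · rwa [hc]
    · simp [hc] at hi
  | parL T h ih =>
    simp only [Tm.chans]
    refine ⟨ih.1.trans Finset.subset_union_left, ?_⟩
    intro Q hQ
    obtain ⟨x, y, hx, hy, rfl⟩ := parD_supp _ _ _ hQ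
    rw [dirac_supp _ _ hy]
    exact Finset.union_subset_union (ih.2 x hx) (subset_refl _)
  | parR S h ih =>
    simp only [Tm.chans]
    refine ⟨ih.1.trans Finset.subset_union_right, ?_⟩
    intro Q hQ
    obtain ⟨x, y, hx, hy, rfl⟩ := parD_supp _ _ _ hQ
    rw [dirac_supp _ _ hx]
    exact Finset.union_subset_union (subset_refl _) (ih.2 y hy)
  | comm hc h1 h2 ih1 ih2 =>
    simp only [Tm.chans]
    refine ⟨by simp [Act.chans], ?_⟩
    intro Q hQ
    obtain ⟨x, y, hx, hy, rfl⟩ := parD_supp _ _ _ hQ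
    exact Finset.union_subset_union (ih1.2 x hx) (ih2.2 y hy)
  | loc L h hal ih =>
    simp only [Tm.chans]
    refine ⟨ih.1.trans Finset.subset_union_right, ?_⟩
    intro Q hQ
    obtain ⟨x, hx, rfl⟩ := locD_supp _ _ _ hQ
    exact Finset.union_subset_union (subset_refl _) (ih.2 x hx)
  | @fixp T β ρ h ih =>
    have hs : (Tm.subst (.fix T) 0 T).chans ⊆ (Tm.fix T).chans := by
      have := chans_subst (.fix T) T 0
      simpa [Tm.chans] using this
    exact ⟨ih.1.trans hs, fun Q hQ => (ih.2 Q hQ).trans hs⟩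

/-! ### Box equivalence is contained in diamond equivalence -/

/-- The process offering the fresh channel `n`. -/
def obsC (n : ℕ) : Tm := Tm.prefix1 (.inp n) .nil

/-- Actions of the observer. -/
def obsA (n : ℕ) (i : Fin (2 * n + 1)) : Act :=
  if i.val < n then .inp i.val else if i.val < 2 * n then .out (i.val - n) else .tau

/-- Continuations of the observer. -/
def obsK (n : ℕ) (i : Fin (2 * n + 1)) : Tm :=
  if i.val < 2 * n then .nil else obsC n

/-- The observer: it may succeed silently, or be killed by any action of the observed term. -/
def obsT (n : ℕ) : Tm := Tm.sum (2 * n) (obsA n) (obsK n)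

theorem obsT_inv {n : ℕ} {α : Act} {ρ : FinDist Tm} (h : Step (obsT n) α ρ) :
    (α = .tau ∧ ρ = dirac (obsC n)) ∨ (α.IsLabel ∧ ρ = dirac .nil) := by
  obtain ⟨i, h1, h2⟩ := step_sum_inv h
  by_cases hi : i.val < 2 * n
  · right
    refine ⟨?_, by simpa [obsK, hi] using h2⟩
    rw [h1, obsA]
    split_ifs <;> trivial
  · left
    have hi' : ¬ i.val < n := by omega
    exact ⟨by simpa [obsA, hi, hi'] using h1, by simpa [obsK, hi] using h2⟩

theorem obsT_tau (n : ℕ) : Step (obsT n) .tau (dirac (obsC n)) := by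
  have := Step.choice (obsA n) (obsK n) ⟨2 * n, by omega⟩
  have h : ¬ 2 * n < n := by omega
  simpa [obsT, obsA, obsK, h] using this

theorem obsT_inp (n a : ℕ) (ha : a < n) : Step (obsT n) (.inp a) (dirac .nil) := by
  have := Step.choice (obsA n) (obsK n) ⟨a, by omega⟩
  have h : a < 2 * n := by omega
  simpa [obsT, obsA, obsK, h, ha] using this

theorem obsT_out (n a : ℕ) (ha : a < n) : Step (obsT n) (.out a) (dirac .nil) := by
  have := Step.choice (obsA n) (obsK n) ⟨n + a, by omega⟩
  have h : n + a < 2 * n := by omega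
  simpa [obsT, obsA, obsK, h] using this

theorem obsT_ccs (n : ℕ) : (obsT n).IsCCS := by
  refine ⟨⟨?_, ?_, ?_⟩, ?_⟩
  · intro i
    unfold obsK
    split_ifs
    · trivial
    · exact fun _ => trivial
  · intro i
    unfold obsA
    split_ifs <;> simp
  · intro i
    unfold obsK
    split_ifs
    · trivial
    · exact ⟨fun _ => by simp, fun _ => trivial⟩
  · intro i
    unfold obsK
    split_ifs
    · trivial
    · exact fun _ => trivial

/-- The testing configuration. -/
def conf (n : ℕ) (P U : Tm) : Tm := .loc (Finset.range n) (.par P U)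

theorem ex_conf_parL (n : ℕ) (ρ : FinDist Tm) (U : Tm) (f : Tm → ℝ) :
    (locD (Finset.range n) (ρ.parD (dirac U))).ex f = ρ.ex (fun P => f (conf n P U)) := by
  simp [ex_locD, ex_parD, ex_dirac, conf]

theorem conf_left (n : ℕ) {P U : Tm} {ρ : FinDist Tm} (h : Step P .tau ρ) :
    Step (conf n P U) .tau (locD (Finset.range n) (ρ.parD (dirac U))) :=
  Step.loc _ (Step.parL U h) (by trivial)

theorem Vm_conf_C (n : ℕ) (P : Tm) : 1 ≤ Vm (conf n P (obsC n)) := by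
  apply Vm_psi
  refine ⟨.inp n, _, trivial, Step.loc _ (Step.parR P (step_pfx _ _)) ?_⟩
  simp [Act.Allowed]

theorem Vm_conf_T (n : ℕ) (P : Tm) : 1 ≤ Vm (conf n P (obsT n)) := by
  have h : Step (conf n P (obsT n)) .tau _ :=
    Step.loc (Finset.range n) (Step.parR P (obsT_tau n)) (by trivial)
  have h2 := Vm_step h
  rw [ex_conf_parL, ex_dirac] at h2
  exact (Vm_conf_C n P).trans h2

theorem Vm_conf_nil (n : ℕ) (P : Tm) (hP : P.chans ⊆ Finset.range n) :
    Vm (conf n P .nil) ≤ 0 := by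
  have h := Vm_le_pot (conf n P .nil)
    (fun Q => if ∃ P, P.chans ⊆ Finset.range n ∧ Q = conf n P .nil then 0 else 1) ?_ ?_ ?_
  · have hc : ∃ P', P'.chans ⊆ Finset.range n ∧ conf n P .nil = conf n P' .nil := ⟨P, hP, rfl⟩
    simpa only [if_pos hc] using h
  · intro P; try dsimp only
    split_ifs <;> norm_num
  · rintro Q ⟨α, ρ, hα, hst⟩
    try dsimp only
    split_ifs with hQ
    · obtain ⟨P, hP, rfl⟩ := hQ
      obtain ⟨σ', rfl, hs0, hal⟩ := step_loc_inv hst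
      rcases step_par_inv hs0 with ⟨σ, rfl, hσ⟩ | ⟨σ, rfl, hσ⟩ | ⟨ℓ1, ℓ2, ρ1, ρ2, rfl, hc, h1, h2, rfl⟩
      · have h1 := (chans_step hσ).1.trans hP
        cases α with
        | inp a => exact absurd (h1 (by simp [Act.chans])) hal
        | out a => exact absurd (h1 (by simp [Act.chans])) hal
        | tau => exact absurd hα id
        | omega => exact absurd hα id
      · exact (step_nil_inv hσ).elim
      · exact (step_nil_inv h2).elim
    · exact le_refl _
  · intro Q ρ hst
    try dsimp only
    split_ifs with hQ
    · obtain ⟨P, hP, rfl⟩ := hQ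
      obtain ⟨σ', rfl, hs0, hal⟩ := step_loc_inv hst
      rcases step_par_inv hs0 with ⟨σ, rfl, hσ⟩ | ⟨σ, rfl, hσ⟩ | ⟨ℓ1, ℓ2, ρ1, ρ2, _, hc, h1, h2, rfl⟩
      · rw [ex_conf_parL, ex_congr σ (g := fun _ => 0), ex_const]
        intro a ha
        exact if_pos ⟨a, ((chans_step hσ).2 a ha).trans hP, rfl⟩
      · exact (step_nil_inv hσ).elim
      · exact (step_nil_inv h2).elim
    · have := ρ.ex_mono (g := fun _ => 1)
        (f := fun Q => if ∃ P, P.chans ⊆ Finset.range n ∧ Q = conf n P .nil then (0 : ℝ) else 1)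
        (by intro x _; split_ifs <;> norm_num)
      rwa [ex_const] at this

/-- Lower potential for the fair value of testing configurations. -/
noncomputable def gpot (n : ℕ) : Tm → ℝ
  | .loc L (.par P U) =>
      if L = Finset.range n ∧ P.chans ⊆ Finset.range n then
        (if U = obsT n then 1 - Vm P else if U = obsC n then 1 else 0)
      else 0
  | _ => 0

theorem gpot_T (n : ℕ) (P : Tm) (hP : P.chans ⊆ Finset.range n) :
    gpot n (conf n P (obsT n)) = 1 - Vm P := by
  simp [gpot, conf, hP]

theorem gpot_C (n : ℕ) (P : Tm) (hP : P.chans ⊆ Finset.range n) :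
    1 - Vm P ≤ gpot n (conf n P (obsC n)) := by
  simp only [gpot, conf, hP, and_self, if_true]
  split_ifs
  · exact le_refl _
  · linarith [Vm_nonneg P]

theorem gpot_C' (n : ℕ) (P : Tm) (hP : P.chans ⊆ Finset.range n) (hn : obsC n ≠ obsT n) :
    gpot n (conf n P (obsC n)) = 1 := by
  simp [gpot, conf, hP, hn]

theorem gpot_cases (n : ℕ) (Q : Tm) :
    gpot n Q = 0 ∨ (∃ P, P.chans ⊆ Finset.range n ∧ Q = conf n P (obsT n)) ∨
    (obsC n ≠ obsT n ∧ ∃ P, P.chans ⊆ Finset.range n ∧ Q = conf n P (obsC n)) := by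
  unfold gpot
  split
  · rename_i L P U
    by_cases h : L = Finset.range n ∧ P.chans ⊆ Finset.range n
    · obtain ⟨rfl, h2⟩ := h
      by_cases hU : U = obsT n
      · subst hU
        exact Or.inr (Or.inl ⟨P, h2, rfl⟩)
      · by_cases hC : U = obsC n
        · subst hC
          exact Or.inr (Or.inr ⟨hU, P, h2, rfl⟩)
        · left; simp [hU, hC]
    · left; simp [h]
  · left; rfl

theorem gpot_nonneg (n : ℕ) (Q : Tm) : 0 ≤ gpot n Q := by
  rcases gpot_cases n Q with h | ⟨P, hP, rfl⟩ | ⟨hn, P, hP, rfl⟩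
  · rw [h]
  · rw [gpot_T n P hP]; linarith [Vm_le_one P]
  · rw [gpot_C' n P hP hn]; norm_num

theorem ex_gpot_nonneg (n : ℕ) (ρ : FinDist Tm) : 0 ≤ ρ.ex (gpot n) := by
  have := ρ.ex_mono (f := fun _ => 0) (g := gpot n) (fun a _ => gpot_nonneg n a)
  rwa [ex_const] at this

theorem gpot_step (n : ℕ) (Q : Tm) (ρ : FinDist Tm) (hst : Step Q .tau ρ) :
    gpot n Q ≤ ρ.ex (gpot n) := by
  rcases gpot_cases n Q with h | ⟨P, hP, rfl⟩ | ⟨hn, P, hP, rfl⟩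
  · rw [h]; exact ex_gpot_nonneg n ρ
  · rw [gpot_T n P hP]
    obtain ⟨σ', rfl, hs0, hal⟩ := step_loc_inv hst
    rcases step_par_inv hs0 with ⟨σ, rfl, hσ⟩ | ⟨σ, rfl, hσ⟩ | ⟨ℓ1, ℓ2, ρ1, ρ2, _, hc, h1, h2, rfl⟩
    · rw [ex_conf_parL, ex_congr σ (g := fun P => 1 - Vm P)
        (fun a ha => gpot_T n a (((chans_step hσ).2 a ha).trans hP)), ex_sub, ex_const]
      have := Vm_step hσ
      linarith
    · rcases obsT_inv hσ with ⟨_, rfl⟩ | ⟨h, _⟩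
      · rw [ex_conf_parL, ex_dirac]
        exact gpot_C n P hP
      · exact absurd h id
    · have : P ∈ psiL := by
        refine ⟨ℓ1, ρ1, ?_, h1⟩
        obtain ⟨a, ⟨rfl, _⟩ | ⟨rfl, _⟩⟩ := hc <;> trivial
      have := Vm_psi this
      have := ex_gpot_nonneg n (locD (Finset.range n) (ρ1.parD ρ2))
      linarith
  · rw [gpot_C' n P hP hn]
    obtain ⟨σ', rfl, hs0, hal⟩ := step_loc_inv hst
    rcases step_par_inv hs0 with ⟨σ, rfl, hσ⟩ | ⟨σ, rfl, hσ⟩ | ⟨ℓ1, ℓ2, ρ1, ρ2, _, hc, h1, h2, rfl⟩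
    · rw [ex_conf_parL, ex_congr σ (g := fun P => 1)
        (fun a ha => gpot_C' n a (((chans_step hσ).2 a ha).trans hP) hn), ex_const]
    · have := (step_pfx_inv hσ).1
      cases this
    · exfalso
      have h3 := (step_pfx_inv h2).1
      subst h3
      have h4 := (chans_step h1).1.trans hP
      obtain ⟨a, ⟨_, h⟩ | ⟨rfl, h⟩⟩ := hc
      · cases h
      · cases h
        have := h4 (x := n) (by simp [Act.chans])
        simp at this

theorem gpot_le (n : ℕ) (Q : Tm) : gpot n Q ≤ Vm Q := by
  rcases gpot_cases n Q with h | ⟨P, hP, rfl⟩ | ⟨hn, P, hP, rfl⟩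
  · rw [h]; exact Vm_nonneg Q
  · rw [gpot_T n P hP]; linarith [Vm_nonneg P, Vm_conf_T n P]
  · rw [gpot_C' n P hP hn]; exact Vm_conf_C n P

theorem Vf_le_one (P : Tm) : Vf P ≤ 1 := (Vf_le_Vm P).trans (Vm_le_one P)

theorem Vf_conf (n : ℕ) (P : Tm) (hP : P.chans ⊆ Finset.range n) :
    Vf (conf n P (obsT n)) ≤ 1 - Vm P := by
  have h := Vm_le_pot P (fun P => if P.chans ⊆ Finset.range n then
    1 - Vf (conf n P (obsT n)) else 1) ?_ ?_ ?_
  · simp only [if_pos hP] at h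
    linarith
  · intro P
    try dsimp only
    split_ifs
    · linarith [Vf_le_one (conf n P (obsT n))]
    · norm_num
  · intro P hpsi
    try dsimp only
    split_ifs with hP
    · obtain ⟨α, ρ, hα, hst⟩ := hpsi
      have hch := chans_step hst
      have key : Step (conf n P (obsT n)) .tau (locD (Finset.range n) (ρ.parD (dirac .nil))) := by
        refine Step.loc _ ?_ (by trivial)
        cases α with
        | inp a =>
          have : a ∈ Finset.range n := hP (hch.1 (by simp [Act.chans]))
          exact Step.comm ⟨a, Or.inl ⟨rfl, rfl⟩⟩ hst (obsT_out n a (by simpa using this))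
        | out a =>
          have : a ∈ Finset.range n := hP (hch.1 (by simp [Act.chans]))
          exact Step.comm ⟨a, Or.inr ⟨rfl, rfl⟩⟩ hst (obsT_inp n a (by simpa using this))
        | tau => exact absurd hα id
        | omega => exact absurd hα id
      have h1 := Vf_step key
      rw [ex_conf_parL] at h1
      have h2 := ρ.ex_mono (f := fun P => Vf (conf n P .nil)) (g := fun _ => 0)
        (fun a ha => (Vf_le_Vm _).trans (Vm_conf_nil n a ((hch.2 a ha).trans hP)))
      rw [ex_const] at h2
      linarith
    · exact le_refl _
  · intro P ρ hst
    try dsimp only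
    split_ifs with hP
    · rw [ex_congr ρ (g := fun P => 1 - Vf (conf n P (obsT n)))
        (fun a ha => if_pos (((chans_step hst).2 a ha).trans hP)), ex_sub, ex_const]
      have h1 := Vf_step (conf_left n (U := obsT n) hst)
      rw [ex_conf_parL] at h1
      linarith
    · have := ρ.ex_mono (g := fun _ => 1) (f := fun P => if P.chans ⊆ Finset.range n then
          1 - Vf (conf n P (obsT n)) else 1)
        (by intro x _; split_ifs
            · linarith [Vf_nonneg (conf n x (obsT n))]
            · exact le_refl _)
      rwa [ex_const] at this

theorem fair_conf (n : ℕ) (μ : FinDist Tm) (hμ : ∀ P, μ.toFun P ≠ 0 → P.chans ⊆ Finset.range n) :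
    chiFairL (locD (Finset.range n) (μ.parD (dirac (obsT n)))) = 1 - chiMayL μ := by
  apply le_antisymm
  · refine (fair_le_ex _).trans ?_
    rw [ex_conf_parL, may_eq]
    have := μ.ex_mono (f := fun P => Vf (conf n P (obsT n))) (g := fun P => 1 - Vm P)
      (fun a ha => Vf_conf n a (hμ a ha))
    rwa [ex_sub, ex_const] at this
  · refine le_trans ?_ (pot_le_fair _ (gpot n) (gpot_le n) (gpot_step n))
    rw [ex_conf_parL, may_eq, ex_congr μ (g := fun P => 1 - Vm P)
      (fun a ha => gpot_T n a (hμ a ha)), ex_sub, ex_const]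

theorem exists_bound (μ : FinDist Tm) :
    ∃ n, ∀ P, μ.toFun P ≠ 0 → P.chans ⊆ Finset.range n := by
  obtain ⟨n, hn⟩ := (μ.finite_support.toFinset.biUnion Tm.chans).exists_nat_subset_range
  refine ⟨n, fun P hP x hx => hn ?_⟩
  rw [Finset.mem_biUnion]
  exact ⟨P, by simpa using hP, hx⟩

theorem box_le_diamond (D : Set (FinDist Tm)) (hD : IsTestingContext D) (μ1 μ2 : FinDist Tm)
    (h : BoxEq D μ1 μ2) : DiamondEq D μ1 μ2 := by
  obtain ⟨R, hR, hE, h⟩ := h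
  refine ⟨R, ?_, hE, h⟩
  intro ν1 ν2 hν
  obtain ⟨n1, h1⟩ := exists_bound ν1
  obtain ⟨n2, h2⟩ := exists_bound ν2
  have hm : ∀ m ≤ max n1 n2, Finset.range m ⊆ Finset.range (max n1 n2) := fun m hm =>
    Finset.range_subset_range.mpr hm
  have h3 := (hE _ _ ((hE _ _ hν).1 _ (hD.dirac_ccs _ (obsT_ccs (max n1 n2))))).2
    (Finset.range (max n1 n2))
  have h4 := hR _ _ h3
  rw [fair_conf _ _ fun P hP => (h1 P hP).trans (hm _ (le_max_left _ _)),
    fair_conf _ _ fun P hP => (h2 P hP).trans (hm _ (le_max_right _ _))] at h4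
  linarith

/-- For every testing context `𝒟`, the box equivalence is strictly
contained in the diamond equivalence, the strictness being witnessed by
`τ.a` and `τ.a + τ.(μX.τ.X)`. -/
theorem box_strictly_finer_than_diamond
    (D : Set (FinDist Tm)) (hD : IsTestingContext D) :
    (∀ μ1 μ2 : FinDist Tm, BoxEq D μ1 μ2 → DiamondEq D μ1 μ2) ∧
    (∀ a : Chan,
      DiamondEq D (FinDist.dirac (tauA a)) (FinDist.dirac (tauAOrDiverge a)) ∧
      ¬ BoxEq D (FinDist.dirac (tauA a)) (FinDist.dirac (tauAOrDiverge a))) :=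
  ⟨fun μ1 μ2 h => box_le_diamond D hD μ1 μ2 h, fun a => ⟨diamond_AB D a, not_box_AB D a⟩⟩
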